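/- The number of conjugacy classes of subgroups of index n in π₁(𝒢₆) isomorphic to π₁(𝒢₆) equals the number of ordered triples (k, ℓ, m) of odd positive integers with kℓm = n, i.e. equals d_3(n) - 3d_3(n/2) + 3d_3(n/4) - d_3(n/8). -/

import Mathlib

/-- The relations of the Hantzsche–Wendt group:
`x y² x⁻¹ y² = 1`, `y x² y⁻¹ x² = 1`, `x y z = 1`, with `x, y, z` the generators `0, 1, 2`. -/
def hwRels : Set (FreeGroup (Fin 3)) :=
  { FreeGroup.of 0 * FreeGroup.of 1 ^ 2 * (FreeGroup.of 0)⁻¹ * FreeGroup.of 1 ^ 2,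
    FreeGroup.of 1 * FreeGroup.of 0 ^ 2 * (FreeGroup.of 1)⁻¹ * FreeGroup.of 0 ^ 2,
    FreeGroup.of 0 * FreeGroup.of 1 * FreeGroup.of 2 }

/-- The fundamental group of the Hantzsche–Wendt manifold `𝒢₆`. -/
abbrev HW : Type := PresentedGroup hwRels

def hwx : HW := PresentedGroup.of 0
def hwy : HW := PresentedGroup.of 1
def hwz : HW := PresentedGroup.of 2

/-- `d3 n` = number of ordered triples `(a,b,c)` of positive integers with `a*b*c = n`. -/
def d3 (n : ℕ) : ℕ :=
  ((Finset.range (n+1) ×ˢ Finset.range (n+1) ×ˢ Finset.range (n+1)).filter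
    (fun t => 0 < t.1 ∧ 0 < t.2.1 ∧ 0 < t.2.2 ∧ t.1 * t.2.1 * t.2.2 = n)).card

/-- `d3If n k` = `d3 (n / k)` if `k ∣ n`, and `0` otherwise. -/
def d3If (n k : ℕ) : ℕ := if k ∣ n then d3 (n / k) else 0

/-- Number of ordered triples `(k,ℓ,m)` of odd positive integers with `k*ℓ*m = n`. -/
def oddTriples (n : ℕ) : ℕ :=
  ((Finset.range (n+1) ×ˢ Finset.range (n+1) ×ˢ Finset.range (n+1)).filter
    (fun t => Odd t.1 ∧ Odd t.2.1 ∧ Odd t.2.2 ∧ t.1 * t.2.1 * t.2.2 = n)).card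

/-- The conjugacy class of a subgroup `H`. -/
def conjClass (H : Subgroup HW) : Set (Subgroup HW) :=
  {K | ∃ g : HW, K = H.map (MulAut.conj g).toMonoidHom}


/-- The number of triples `(a, b, c)` with `p a`, `q b`, `r c` and `k * a * b * c = n`. -/
def tripleCount (p q r : ℕ → Prop) [DecidablePred p] [DecidablePred q] [DecidablePred r]
    (k n : ℕ) : ℕ :=
  ((Finset.range (n+1) ×ˢ Finset.range (n+1) ×ˢ Finset.range (n+1)).filter
    (fun t => p t.1 ∧ q t.2.1 ∧ r t.2.2 ∧ k * (t.1 * t.2.1 * t.2.2) = n)).card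

section tripleCount

variable (p q r : ℕ → Prop) [DecidablePred p] [DecidablePred q] [DecidablePred r]

theorem tripleCount_swap (k n : ℕ) : tripleCount p q r k n = tripleCount q p r k n := by
  refine Finset.card_bij (fun t _ => (t.2.1, t.1, t.2.2)) ?_ ?_ ?_
  · rintro ⟨a, b, c⟩ h
    simp only [Finset.mem_filter, Finset.mem_product] at h ⊢
    obtain ⟨⟨h1, h2, h3⟩, h4, h5, h6, h7⟩ := h
    exact ⟨⟨h2, h1, h3⟩, h5, h4, h6, by rw [← h7]; ring⟩
  · rintro ⟨a, b, c⟩ _ ⟨a', b', c'⟩ _ h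
    simp only [Prod.mk.injEq] at h ⊢
    tauto
  · rintro ⟨a, b, c⟩ h
    refine ⟨(b, a, c), ?_, rfl⟩
    simp only [Finset.mem_filter, Finset.mem_product] at h ⊢
    obtain ⟨⟨h1, h2, h3⟩, h4, h5, h6, h7⟩ := h
    exact ⟨⟨h2, h1, h3⟩, h5, h4, h6, by rw [← h7]; ring⟩

theorem tripleCount_rotate (k n : ℕ) : tripleCount p q r k n = tripleCount q r p k n := by
  refine Finset.card_bij (fun t _ => (t.2.1, t.2.2, t.1)) ?_ ?_ ?_
  · rintro ⟨a, b, c⟩ h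
    simp only [Finset.mem_filter, Finset.mem_product] at h ⊢
    obtain ⟨⟨h1, h2, h3⟩, h4, h5, h6, h7⟩ := h
    exact ⟨⟨h2, h3, h1⟩, h5, h6, h4, by rw [← h7]; ring⟩
  · rintro ⟨a, b, c⟩ _ ⟨a', b', c'⟩ _ h
    simp only [Prod.mk.injEq] at h ⊢
    tauto
  · rintro ⟨b, c, a⟩ h
    refine ⟨(a, b, c), ?_, rfl⟩
    simp only [Finset.mem_filter, Finset.mem_product] at h ⊢
    obtain ⟨⟨h1, h2, h3⟩, h4, h5, h6, h7⟩ := h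
    exact ⟨⟨h3, h1, h2⟩, h6, h4, h5, by rw [← h7]; ring⟩

theorem tripleCount_odd_add (k n : ℕ) (hn : 0 < n) :
    tripleCount Odd q r k n + tripleCount (0 < ·) q r (2 * k) n =
      tripleCount (0 < ·) q r k n := by
  have hsplit := Finset.card_filter_add_card_filter_not
    (s := (Finset.range (n+1) ×ˢ Finset.range (n+1) ×ˢ Finset.range (n+1)).filter
      (fun t => 0 < t.1 ∧ q t.2.1 ∧ r t.2.2 ∧ k * (t.1 * t.2.1 * t.2.2) = n))
    (fun t => Odd t.1)
  rw [Finset.filter_filter, Finset.filter_filter] at hsplit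
  unfold tripleCount
  rw [← hsplit]
  congr 1
  · congr 1
    ext ⟨a, b, c⟩
    simp only [Finset.mem_filter]
    have : Odd a → 0 < a := Odd.pos
    tauto
  · refine Finset.card_bij (fun t _ => (2 * t.1, t.2.1, t.2.2)) ?_ ?_ ?_
    · rintro ⟨a, b, c⟩ h
      simp only [Finset.mem_filter, Finset.mem_product, Finset.mem_range] at h ⊢
      obtain ⟨⟨h1, h2, h3⟩, h4, h5, h6, h7⟩ := h
      have h8 : 2 * a ≤ n := Nat.le_of_dvd hn ⟨k * b * c, by rw [← h7]; ring⟩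
      exact ⟨⟨by omega, h2, h3⟩, ⟨by omega, h5, h6, by rw [← h7]; ring⟩, by simp⟩
    · rintro ⟨a, b, c⟩ _ ⟨a', b', c'⟩ _ h
      simp only [Prod.mk.injEq] at h ⊢
      refine ⟨by omega, h.2⟩
    · rintro ⟨a, b, c⟩ h
      simp only [Finset.mem_filter, Finset.mem_product, Finset.mem_range, Nat.not_odd_iff_even] at h
      obtain ⟨⟨h1, h2, h3⟩, ⟨h4, h5, h6, h7⟩, a', rfl⟩ := h
      refine ⟨(a', b, c), ?_, by simp [two_mul]⟩
      simp only [Finset.mem_filter, Finset.mem_product, Finset.mem_range]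
      exact ⟨⟨by omega, h2, h3⟩, by omega, h5, h6, by rw [← h7]; ring⟩

end tripleCount

theorem d3If_eq_tripleCount (n k : ℕ) (hn : 0 < n) (hk : 0 < k) :
    d3If n k = tripleCount (0 < ·) (0 < ·) (0 < ·) k n := by
  unfold d3If
  split_ifs with h
  · obtain ⟨m, rfl⟩ := h
    rw [Nat.mul_div_cancel_left _ hk]
    unfold d3 tripleCount
    congr 1
    ext ⟨a, b, c⟩
    simp only [Finset.mem_filter, Finset.mem_product, Finset.mem_range,
      Nat.mul_right_inj hk.ne']
    have hm : 0 < m := Nat.pos_of_mul_pos_left hn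
    have hmk : m ≤ k * m := Nat.le_mul_of_pos_left m hk
    constructor
    · rintro ⟨⟨h1, h2, h3⟩, h⟩
      exact ⟨⟨by omega, by omega, by omega⟩, h⟩
    · rintro ⟨_, h⟩
      have h1 : a ≤ m := Nat.le_of_dvd hm ⟨b * c, by rw [← h.2.2.2]; ring⟩
      have h2 : b ≤ m := Nat.le_of_dvd hm ⟨a * c, by rw [← h.2.2.2]; ring⟩
      have h3 : c ≤ m := Nat.le_of_dvd hm ⟨a * b, by rw [← h.2.2.2]; ring⟩
      exact ⟨⟨by omega, by omega, by omega⟩, h⟩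
  · symm
    unfold tripleCount
    rw [Finset.card_eq_zero, Finset.filter_eq_empty_iff]
    rintro t _ ⟨-, -, -, ht⟩
    exact h ⟨_, ht.symm⟩

theorem oddTriples_eq (n : ℕ) (hn : 0 < n) :
    (oddTriples n : ℤ) = (d3 n : ℤ) - 3 * d3If n 2 + 3 * d3If n 4 - d3If n 8 := by
  have h0 : oddTriples n = tripleCount Odd Odd Odd 1 n := by
    simp only [oddTriples, tripleCount, one_mul]
  have h1 : d3 n = d3If n 1 := by simp [d3If]
  have hA (k : ℕ) := tripleCount_odd_add Odd Odd k n hn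
  have hB (k : ℕ) : tripleCount (0 < ·) Odd Odd k n + tripleCount (0 < ·) (0 < ·) Odd (2 * k) n
      = tripleCount (0 < ·) (0 < ·) Odd k n := by
    rw [tripleCount_swap, tripleCount_odd_add _ _ k n hn]
  have hC (k : ℕ) : tripleCount (0 < ·) (0 < ·) Odd k n +
      tripleCount (0 < ·) (0 < ·) (0 < ·) (2 * k) n
      = tripleCount (0 < ·) (0 < ·) (0 < ·) k n := by
    rw [← tripleCount_rotate, tripleCount_odd_add _ _ k n hn]
  rw [h0, h1]
  simp only [d3If_eq_tripleCount n _ hn, Nat.one_pos, Nat.ofNat_pos]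
  have := hA 1
  have := hB 1
  have := hB 2
  have := hC 1
  have := hC 2
  have := hC 4
  norm_num at *
  omega

/-- The sign `(-1) ^ n`. -/
def paritySign (n : ℤ) : ℤ := if Even n then 1 else -1

theorem paritySign_of_even {n : ℤ} (h : Even n) : paritySign n = 1 := if_pos h

theorem paritySign_of_odd {n : ℤ} (h : Odd n) : paritySign n = -1 :=
  if_neg (Int.not_even_iff_odd.2 h)

theorem paritySign_eq_or (n : ℤ) : paritySign n = 1 ∨ paritySign n = -1 := by
  unfold paritySign
  split_ifs <;> simp

@[simp] theorem paritySign_zero : paritySign 0 = 1 := by simp [paritySign]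

@[simp] theorem paritySign_one : paritySign 1 = -1 := by simp [paritySign]

@[simp] theorem paritySign_mul_self (n : ℤ) : paritySign n * paritySign n = 1 := by
  rcases paritySign_eq_or n with h | h <;> simp [h]

@[simp] theorem paritySign_neg (n : ℤ) : paritySign (-n) = paritySign n := by
  simp [paritySign]

theorem paritySign_add (m n : ℤ) : paritySign (m + n) = paritySign m * paritySign n := by
  unfold paritySign
  simp only [Int.even_add]
  split_ifs <;> simp_all

@[simp] theorem paritySign_paritySign_mul (m n : ℤ) :
    paritySign (paritySign m * n) = paritySign n := by
  rcases paritySign_eq_or m with h | h <;> simp [h]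

theorem paritySign_odd_mul {k : ℤ} (hk : Odd k) (n : ℤ) : paritySign (k * n) = paritySign n := by
  have : ¬ Even k := Int.not_even_iff_odd.2 hk
  simp [paritySign, Int.even_mul, this]

theorem even_paritySign_mul {m n : ℤ} : Even (paritySign m * n) ↔ Even n := by
  rcases paritySign_eq_or m with h | h <;> simp [h]

/-- A coordinate model of the Hantzsche–Wendt group: the element `(a, b, c)` is the isometry of
`ℝ³` with translation part `(a, b, c)` and linear part the diagonal matrix with entries
`(-1) ^ c`, `(-1) ^ a`, `(-1) ^ b`. -/
@[ext]
structure HWModel where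
  a : ℤ
  b : ℤ
  c : ℤ
  even : Even (a + b + c)

namespace HWModel

instance : Mul HWModel where
  mul s t := ⟨s.a + paritySign s.c * t.a, s.b + paritySign s.a * t.b, s.c + paritySign s.b * t.c, by
    have hs := s.even
    have ht := t.even
    simp only [Int.even_add, even_paritySign_mul] at *
    tauto⟩

instance : One HWModel where
  one := ⟨0, 0, 0, by simp⟩

instance : Inv HWModel where
  inv t := ⟨-(paritySign t.c * t.a), -(paritySign t.a * t.b), -(paritySign t.b * t.c), by
    have ht := t.even
    simp only [Int.even_add, even_neg, even_paritySign_mul] at *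
    tauto⟩

@[simp] theorem mul_a (s t : HWModel) : (s * t).a = s.a + paritySign s.c * t.a := rfl
@[simp] theorem mul_b (s t : HWModel) : (s * t).b = s.b + paritySign s.a * t.b := rfl
@[simp] theorem mul_c (s t : HWModel) : (s * t).c = s.c + paritySign s.b * t.c := rfl
@[simp] theorem one_a : (1 : HWModel).a = 0 := rfl
@[simp] theorem one_b : (1 : HWModel).b = 0 := rfl
@[simp] theorem one_c : (1 : HWModel).c = 0 := rfl
@[simp] theorem inv_a (t : HWModel) : (t⁻¹).a = -(paritySign t.c * t.a) := rfl
@[simp] theorem inv_b (t : HWModel) : (t⁻¹).b = -(paritySign t.a * t.b) := rfl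
@[simp] theorem inv_c (t : HWModel) : (t⁻¹).c = -(paritySign t.b * t.c) := rfl

instance : Group HWModel :=
  Group.ofLeftAxioms
    (fun r s t => by ext <;> simp [paritySign_add] <;> ring)
    (fun t => by ext <;> simp)
    (fun t => by ext <;> simp)

/-- The translation by `(2u, 2v, 2w)`. -/
def translation (u v w : ℤ) : HWModel :=
  ⟨2 * u, 2 * v, 2 * w, by simp [Int.even_add]⟩

@[simp] theorem translation_a (u v w : ℤ) : (translation u v w).a = 2 * u := rfl
@[simp] theorem translation_b (u v w : ℤ) : (translation u v w).b = 2 * v := rfl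
@[simp] theorem translation_c (u v w : ℤ) : (translation u v w).c = 2 * w := rfl

@[simp] theorem paritySign_two_mul (n : ℤ) : paritySign (2 * n) = 1 :=
  paritySign_of_even (even_two_mul n)

theorem translation_mul (u v w u' v' w' : ℤ) :
    translation u v w * translation u' v' w' = translation (u + u') (v + v') (w + w') := by
  ext <;> simp [mul_add]

theorem translation_zpow (u v w i : ℤ) :
    translation u v w ^ i = translation (i * u) (i * v) (i * w) := by
  let f : Multiplicative ℤ →* HWModel :=
    { toFun := fun i => translation (i.toAdd * u) (i.toAdd * v) (i.toAdd * w)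
      map_one' := by ext <;> simp
      map_mul' := fun i j => by simp [translation_mul, add_mul] }
  have h : f (Multiplicative.ofAdd 1) = translation u v w := by simp [f]
  rw [← h, ← map_zpow, ← ofAdd_zsmul]
  simp [f]

/-- The elements all of whose coordinates are divisible by `k`, `l`, `m` respectively. -/
def sublattice (k l m : ℤ) : Subgroup HWModel where
  carrier := {t | k ∣ t.a ∧ l ∣ t.b ∧ m ∣ t.c}
  mul_mem' hs ht := ⟨dvd_add hs.1 (ht.1.mul_left _), dvd_add hs.2.1 (ht.2.1.mul_left _),
    dvd_add hs.2.2 (ht.2.2.mul_left _)⟩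
  one_mem' := by simp
  inv_mem' ht := ⟨(dvd_neg.2 (ht.1.mul_left _)), (dvd_neg.2 (ht.2.1.mul_left _)),
    (dvd_neg.2 (ht.2.2.mul_left _))⟩

theorem mem_sublattice {k l m : ℤ} {t : HWModel} :
    t ∈ sublattice k l m ↔ k ∣ t.a ∧ l ∣ t.b ∧ m ∣ t.c := Iff.rfl

/-- Scaling the coordinates by odd factors. -/
def scale {k l m : ℤ} (hk : Odd k) (hl : Odd l) (hm : Odd m) : HWModel →* HWModel where
  toFun t := ⟨k * t.a, l * t.b, m * t.c, by
    have ht := t.even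
    simp only [← Int.not_even_iff_odd] at hk hl hm
    simp only [Int.even_add, Int.even_mul] at *
    tauto⟩
  map_one' := by ext <;> simp
  map_mul' s t := by
    ext <;> simp only [mul_a, mul_b, mul_c, paritySign_odd_mul hk, paritySign_odd_mul hl,
      paritySign_odd_mul hm] <;> ring

theorem scale_injective {k l m : ℤ} (hk : Odd k) (hl : Odd l) (hm : Odd m) :
    Function.Injective (scale hk hl hm) := by
  intro s t h
  have hk0 : k ≠ 0 := by rintro rfl; simp at hk
  have hl0 : l ≠ 0 := by rintro rfl; simp at hl
  have hm0 : m ≠ 0 := by rintro rfl; simp at hm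
  ext
  · exact mul_left_cancel₀ hk0 (congrArg HWModel.a h)
  · exact mul_left_cancel₀ hl0 (congrArg HWModel.b h)
  · exact mul_left_cancel₀ hm0 (congrArg HWModel.c h)

theorem range_scale {k l m : ℤ} (hk : Odd k) (hl : Odd l) (hm : Odd m) :
    (scale hk hl hm).range = sublattice k l m := by
  ext t
  constructor
  · rintro ⟨s, rfl⟩
    exact ⟨dvd_mul_right _ _, dvd_mul_right _ _, dvd_mul_right _ _⟩
  · obtain ⟨a, b, c, h⟩ := t
    rintro ⟨⟨a, rfl⟩, ⟨b, rfl⟩, ⟨c, rfl⟩⟩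
    refine ⟨⟨a, b, c, ?_⟩, rfl⟩
    simp only [← Int.not_even_iff_odd] at hk hl hm
    simp only [Int.even_add, Int.even_mul] at *
    tauto

theorem exists_even_cast_eq {k : ℕ} (hk : Odd k) (z : ZMod k) :
    ∃ a : ℤ, Even a ∧ (a : ZMod k) = z := by
  obtain ⟨a, rfl⟩ := ZMod.intCast_surjective z
  rcases Int.even_or_odd a with h | h
  · exact ⟨a, h, rfl⟩
  · exact ⟨a + k, h.add_odd (by exact_mod_cast hk), by simp⟩

theorem index_sublattice {k l m : ℕ} (hk : Odd k) (hl : Odd l) (hm : Odd m) :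
    (sublattice k l m).index = k * l * m := by
  let f : HWModel → ZMod k × ZMod l × ZMod m := fun t => (t.a, t.b, t.c)
  have hf (s t : HWModel) : s⁻¹ * t ∈ sublattice k l m ↔ f s = f t := by
    have key (p : ℕ) (e x y : ℤ) :
        (p : ℤ) ∣ -(paritySign e * x) + paritySign e * y ↔ (x : ZMod p) = y := by
      rw [ZMod.intCast_eq_intCast_iff_dvd_sub]
      rcases paritySign_eq_or e with h | h <;> rw [h]
      · rw [show -(1 * x) + 1 * y = y - x by ring]
      · rw [show -(-1 * x) + -1 * y = -(y - x) by ring, dvd_neg]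
    simp [mem_sublattice, f, key]
  have hsurj : Function.Surjective f := by
    rintro ⟨x, y, z⟩
    obtain ⟨a, ha, rfl⟩ := exists_even_cast_eq hk x
    obtain ⟨b, hb, rfl⟩ := exists_even_cast_eq hl y
    obtain ⟨c, hc, rfl⟩ := exists_even_cast_eq hm z
    exact ⟨⟨a, b, c, (ha.add hb).add hc⟩, rfl⟩
  let F : HWModel ⧸ sublattice k l m → ZMod k × ZMod l × ZMod m :=
    Quotient.lift f fun s t h => (hf s t).1 (QuotientGroup.leftRel_apply.1 h)
  have hF : Function.Bijective F := by
    constructor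
    · rintro ⟨s⟩ ⟨t⟩ h
      exact QuotientGroup.eq.2 ((hf s t).2 h)
    · intro z
      obtain ⟨t, rfl⟩ := hsurj z
      exact ⟨QuotientGroup.mk t, rfl⟩
  rw [Subgroup.index, Nat.card_eq_of_bijective F hF]
  simp [Nat.card_prod, mul_assoc]

theorem dvd_of_conj_mem_sublattice {k l m k' l' m' : ℕ}
    (hk' : Odd k') (hl' : Odd l') (hm' : Odd m') {g : HWModel}
    (h : ∀ t ∈ sublattice k l m, g * t * g⁻¹ ∈ sublattice k' l' m') :
    k' ∣ k ∧ l' ∣ l ∧ m' ∣ m := by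
  have key {p q : ℕ} (hp : Odd p) {e : ℤ} (h : (p : ℤ) ∣ paritySign e * (2 * q)) : p ∣ q := by
    have h2 : (p : ℤ) ∣ 2 * q := by
      rcases paritySign_eq_or e with he | he <;> simpa [he] using h
    have h3 : p ∣ 2 * q := by exact_mod_cast h2
    exact (Nat.Coprime.dvd_mul_left (Nat.coprime_two_right.2 hp)).1 h3
  have ht (u v w : ℤ) : g * translation u v w * g⁻¹ =
      translation (paritySign g.c * u) (paritySign g.a * v) (paritySign g.b * w) := by
    rcases paritySign_eq_or g.a with ha | ha <;> rcases paritySign_eq_or g.b with hb | hb <;>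
      rcases paritySign_eq_or g.c with hc | hc <;> ext <;> simp [paritySign_add, ha, hb, hc]
  have h1 := h (translation k l m) (by simp [mem_sublattice])
  rw [ht] at h1
  simp only [mem_sublattice, translation_a, translation_b, translation_c, mul_left_comm] at h1
  exact ⟨key hk' h1.1, key hl' h1.2.1, key hm' h1.2.2⟩

end HWModel

namespace HWModel

/-- The image of the generator `x`. -/
def genX : HWModel := ⟨1, 1, 0, by decide⟩

/-- The image of the generator `y`. -/
def genY : HWModel := ⟨0, 1, 1, by decide⟩

/-- The homomorphism from the presented group to its coordinate model. -/
def ofHW : HW →* HWModel :=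
  PresentedGroup.toGroup (f := ![genX, genY, (genX * genY)⁻¹]) (by
    rintro r (rfl | rfl | rfl) <;> ext <;> simp [genX, genY, pow_two, paritySign_add] ; decide)

@[simp] theorem ofHW_hwx : ofHW hwx = genX := PresentedGroup.toGroup.of _

@[simp] theorem ofHW_hwy : ofHW hwy = genY := PresentedGroup.toGroup.of _

end HWModel

theorem hwx_hwy_rel : hwx * hwy ^ 2 * hwx⁻¹ * hwy ^ 2 = 1 :=
  PresentedGroup.one_of_mem (rels := hwRels) (Or.inl rfl)

theorem hwy_hwx_rel : hwy * hwx ^ 2 * hwy⁻¹ * hwx ^ 2 = 1 :=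
  PresentedGroup.one_of_mem (rels := hwRels) (Or.inr (Or.inl rfl))

theorem hwx_hwy_hwz : hwx * hwy * hwz = 1 :=
  PresentedGroup.one_of_mem (rels := hwRels) (Or.inr (Or.inr rfl))

theorem closure_hwx_hwy : Subgroup.closure {hwx, hwy} = (⊤ : Subgroup HW) := by
  rw [eq_top_iff, ← PresentedGroup.closure_range_of hwRels, Subgroup.closure_le]
  have hx : hwx ∈ Subgroup.closure {hwx, hwy} := Subgroup.subset_closure (by simp)
  have hy : hwy ∈ Subgroup.closure {hwx, hwy} := Subgroup.subset_closure (by simp)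
  rintro _ ⟨i, rfl⟩
  fin_cases i
  · exact hx
  · exact hy
  · change hwz ∈ _
    rw [← inv_eq_of_mul_eq_one_right hwx_hwy_hwz]
    exact inv_mem (mul_mem hx hy)

section NormalForm

variable {G : Type*} [Group G] {x y : G}

theorem semiconjBy_inv_of_rel {u : G} (h : x * u * x⁻¹ * u = 1) : SemiconjBy x u u⁻¹ := by
  rw [SemiconjBy, ← eq_inv_of_mul_eq_one_left h]
  group

theorem SemiconjBy.commute_sq {u : G} (h : SemiconjBy x u u⁻¹) : Commute (x ^ 2) u := by
  have := h.inv_right.mul_left h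
  rwa [inv_inv, ← pow_two] at this

theorem semiconjBy_left_mul_sq (hx : SemiconjBy x (y ^ 2) (y ^ 2)⁻¹)
    (hy : SemiconjBy y (x ^ 2) (x ^ 2)⁻¹) : SemiconjBy x ((x * y) ^ 2) ((x * y) ^ 2)⁻¹ := by
  rw [SemiconjBy, eq_inv_mul_iff_mul_eq]
  calc (x * y) ^ 2 * (x * (x * y) ^ 2) = x * y * x * (y * x ^ 2) * y * x * y := by
        simp only [pow_two, mul_assoc]
    _ = x * y * (x⁻¹ * y ^ 2) * x * y := by rw [hy.eq]; simp only [pow_two]; group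
    _ = x := by
      have h := hx.inv_right.inv_symm_left.eq
      rw [inv_inv] at h
      rw [h]; group

theorem semiconjBy_right_mul_sq (hx : SemiconjBy x (y ^ 2) (y ^ 2)⁻¹)
    (hy : SemiconjBy y (x ^ 2) (x ^ 2)⁻¹) : SemiconjBy y ((x * y) ^ 2) ((x * y) ^ 2)⁻¹ := by
  rw [SemiconjBy, eq_inv_mul_iff_mul_eq]
  calc (x * y) ^ 2 * (y * (x * y) ^ 2) = x * y * (x * y ^ 2) * x * y * x * y := by
        simp only [pow_two, mul_assoc]
    _ = x * (y⁻¹ * x ^ 2) * y * x * y := by rw [hx.eq]; simp only [pow_two]; group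
    _ = y := by
      have h := hy.inv_right.inv_symm_left.eq
      rw [inv_inv] at h
      rw [h]; simp only [pow_two]; group

/-- The elements `(x²)^i (y²)^j ((xy)²)^k` of the translation lattice. -/
def latticeElt (x y : G) (i j k : ℤ) : G := (x ^ 2) ^ i * (y ^ 2) ^ j * ((x * y) ^ 2) ^ k

/-- The products of lattice elements with `1`, `x`, `y` or `xy`. -/
def IsNormalForm (x y g : G) : Prop :=
  ∃ i j k, ∃ w ∈ ({1, x, y, x * y} : Set G), g = latticeElt x y i j k * w

theorem latticeElt_mul (hx : SemiconjBy x (y ^ 2) (y ^ 2)⁻¹) (hy : SemiconjBy y (x ^ 2) (x ^ 2)⁻¹)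
    (i j k i' j' k' : ℤ) : latticeElt x y i j k * latticeElt x y i' j' k' =
      latticeElt x y (i + i') (j + j') (k + k') := by
  have hAB := (hx.commute_sq.zpow_zpow i' j).eq
  have hAW := ((semiconjBy_left_mul_sq hx hy).commute_sq.zpow_zpow i' k).eq
  have hBW := ((semiconjBy_right_mul_sq hx hy).commute_sq.zpow_zpow j' k).eq
  unfold latticeElt
  generalize x ^ 2 = A at *
  generalize y ^ 2 = B at *
  generalize (x * y) ^ 2 = W at *
  calc A ^ i * B ^ j * W ^ k * (A ^ i' * B ^ j' * W ^ k')
      = A ^ i * B ^ j * (W ^ k * A ^ i') * B ^ j' * W ^ k' := by simp only [mul_assoc]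
    _ = A ^ i * (B ^ j * A ^ i') * (W ^ k * B ^ j') * W ^ k' := by
      rw [← hAW]; simp only [mul_assoc]
    _ = _ := by
      rw [← hAB, ← hBW, zpow_add, zpow_add, zpow_add]; simp only [mul_assoc]

theorem left_mul_latticeElt (hx : SemiconjBy x (y ^ 2) (y ^ 2)⁻¹)
    (hy : SemiconjBy y (x ^ 2) (x ^ 2)⁻¹) (i j k : ℤ) :
    x * latticeElt x y i j k = latticeElt x y i (-j) (-k) * x := by
  have hA : SemiconjBy x (x ^ 2) (x ^ 2) := (Commute.refl x).pow_right 2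
  have h := ((hA.zpow_right i).mul_right (hx.zpow_right j)).mul_right
    ((semiconjBy_left_mul_sq hx hy).zpow_right k)
  simpa only [latticeElt, SemiconjBy, inv_zpow'] using h

theorem right_mul_latticeElt (hx : SemiconjBy x (y ^ 2) (y ^ 2)⁻¹)
    (hy : SemiconjBy y (x ^ 2) (x ^ 2)⁻¹) (i j k : ℤ) :
    y * latticeElt x y i j k = latticeElt x y (-i) j (-k) * y := by
  have hB : SemiconjBy y (y ^ 2) (y ^ 2) := (Commute.refl y).pow_right 2
  have h := ((hy.zpow_right i).mul_right (hB.zpow_right j)).mul_right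
    ((semiconjBy_right_mul_sq hx hy).zpow_right k)
  simpa only [latticeElt, SemiconjBy, inv_zpow'] using h

theorem IsNormalForm.latticeElt_mul {g : G} (hx : SemiconjBy x (y ^ 2) (y ^ 2)⁻¹)
    (hy : SemiconjBy y (x ^ 2) (x ^ 2)⁻¹) (hg : IsNormalForm x y g) (i j k : ℤ) :
    IsNormalForm x y (latticeElt x y i j k * g) := by
  obtain ⟨i', j', k', w, hw, rfl⟩ := hg
  exact ⟨_, _, _, w, hw, by rw [← mul_assoc, _root_.latticeElt_mul hx hy]⟩

theorem IsNormalForm.left_mul {g : G} (hx : SemiconjBy x (y ^ 2) (y ^ 2)⁻¹)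
    (hy : SemiconjBy y (x ^ 2) (x ^ 2)⁻¹) (hg : IsNormalForm x y g) :
    IsNormalForm x y (x * g) := by
  obtain ⟨i, j, k, w, hw, rfl⟩ := hg
  rw [← mul_assoc, left_mul_latticeElt hx hy, mul_assoc]
  apply IsNormalForm.latticeElt_mul hx hy
  rcases hw with rfl | rfl | rfl | rfl
  · exact ⟨0, 0, 0, x, by simp, by simp [latticeElt]⟩
  · exact ⟨1, 0, 0, 1, by simp, by simp [latticeElt, pow_two]⟩
  · exact ⟨0, 0, 0, x * w, by simp, by simp [latticeElt]⟩
  · exact ⟨1, 0, 0, y, by simp, by simp [latticeElt, pow_two, mul_assoc]⟩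

theorem right_mul_left (hy : SemiconjBy y (x ^ 2) (x ^ 2)⁻¹) :
    y * x = latticeElt x y (-1) 1 (-1) * (x * y) := by
  have h : y * x * (x * y) = (x ^ 2)⁻¹ * y ^ 2 := by
    calc y * x * (x * y) = y * x ^ 2 * y := by simp only [pow_two, mul_assoc]
      _ = _ := by rw [hy.eq]; simp only [pow_two, mul_assoc]
  rw [← eq_mul_inv_iff_mul_eq] at h
  rw [h]
  simp [latticeElt, pow_two, mul_assoc]

theorem IsNormalForm.right_mul {g : G} (hx : SemiconjBy x (y ^ 2) (y ^ 2)⁻¹)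
    (hy : SemiconjBy y (x ^ 2) (x ^ 2)⁻¹) (hg : IsNormalForm x y g) :
    IsNormalForm x y (y * g) := by
  obtain ⟨i, j, k, w, hw, rfl⟩ := hg
  rw [← mul_assoc, right_mul_latticeElt hx hy, mul_assoc]
  apply IsNormalForm.latticeElt_mul hx hy
  rcases hw with rfl | rfl | rfl | rfl
  · exact ⟨0, 0, 0, y, by simp, by simp [latticeElt]⟩
  · exact ⟨-1, 1, -1, w * y, by simp, right_mul_left hy⟩
  · exact ⟨0, 1, 0, 1, by simp, by simp [latticeElt, pow_two]⟩
  · rw [← mul_assoc, right_mul_left hy, mul_assoc]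
    apply IsNormalForm.latticeElt_mul hx hy
    exact ⟨0, -1, 0, x, by simp, by rw [mul_assoc, ← pow_two, hx.eq]; simp [latticeElt]⟩

theorem isNormalForm_of_closure_eq_top (hx : SemiconjBy x (y ^ 2) (y ^ 2)⁻¹)
    (hy : SemiconjBy y (x ^ 2) (x ^ 2)⁻¹) (hxy : Subgroup.closure {x, y} = ⊤) (g : G) :
    IsNormalForm x y g := by
  have key : ∀ s, IsNormalForm x y s → IsNormalForm x y (g * s) ∧ IsNormalForm x y (g⁻¹ * s) := by
    have hg : g ∈ Subgroup.closure {x, y} := hxy ▸ Subgroup.mem_top g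
    induction hg using Subgroup.closure_induction with
    | mem g hg =>
      intro s hs
      rcases hg with rfl | rfl
      · refine ⟨hs.left_mul hx hy, ?_⟩
        rw [show g⁻¹ * s = latticeElt g y (-1) 0 0 * (g * s) by simp [latticeElt, pow_two]]
        exact (hs.left_mul hx hy).latticeElt_mul hx hy _ _ _
      · refine ⟨hs.right_mul hx hy, ?_⟩
        rw [show g⁻¹ * s = latticeElt x g 0 (-1) 0 * (g * s) by simp [latticeElt, pow_two]]
        exact (hs.right_mul hx hy).latticeElt_mul hx hy _ _ _
    | one => simp
    | mul a b _ _ ha hb =>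
      intro s hs
      rw [mul_assoc, mul_inv_rev, mul_assoc]
      exact ⟨(ha _ (hb s hs).1).1, (hb _ (ha s hs).2).2⟩
    | inv a _ ha =>
      intro s hs
      rw [inv_inv]
      exact (ha s hs).symm
  simpa using (key 1 ⟨0, 0, 0, 1, by simp, by simp [latticeElt]⟩).1

end NormalForm

namespace HWModel

theorem ofHW_injective : Function.Injective ofHW := by
  rw [injective_iff_map_eq_one]
  intro g hg
  obtain ⟨i, j, k, w, hw, rfl⟩ := isNormalForm_of_closure_eq_top
    (semiconjBy_inv_of_rel hwx_hwy_rel) (semiconjBy_inv_of_rel hwy_hwx_rel) closure_hwx_hwy g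
  have hX : genX ^ 2 = translation 1 0 0 := by ext <;> simp [genX, pow_two]
  have hY : genY ^ 2 = translation 0 1 0 := by ext <;> simp [genY, pow_two]
  have hXY : (genX * genY) ^ 2 = translation 0 0 (-1) := by
    ext <;> simp [genX, genY, pow_two]
  have hlat : ofHW (latticeElt hwx hwy i j k) = translation i j (-k) := by
    simp [latticeElt, hX, hY, hXY, translation_zpow, translation_mul]
  rw [map_mul, hlat] at hg
  have ha := congrArg HWModel.a hg
  have hb := congrArg HWModel.b hg
  have hc := congrArg HWModel.c hg
  rcases hw with rfl | rfl | rfl | rfl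
  · simp at ha hb hc
    simp [latticeElt, ha, hb, hc]
  all_goals
    simp [genX, genY] at ha hb hc
    omega

theorem dvd_of_dvd_two_mul {k u : ℤ} (hk : Odd k) (h : k ∣ 2 * u) : k ∣ u := by
  obtain ⟨j, rfl⟩ := hk
  have := (dvd_mul_right (2 * j + 1) u).sub (h.mul_left j)
  rwa [show (2 * j + 1) * u - j * (2 * u) = u by ring] at this

theorem closure_eq_sublattice {X Y : HWModel} (hXa : Odd X.a) (hXb : Odd X.b) (hYa : Even Y.a)
    (hYb : Odd Y.b) (ha : X.a ∣ Y.a) (hb : Y.b ∣ X.b) (hc : X.c - Y.c ∣ X.c) :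
    Subgroup.closure {X, Y} = sublattice X.a Y.b (X.c - Y.c) := by
  have hXc : Even X.c := by have := X.even; grind
  have hYc : Odd Y.c := by have := Y.even; grind
  have hXm : X ∈ Subgroup.closure {X, Y} := Subgroup.subset_closure (by simp)
  have hYm : Y ∈ Subgroup.closure {X, Y} := Subgroup.subset_closure (by simp)
  have hle : Subgroup.closure {X, Y} ≤ sublattice X.a Y.b (X.c - Y.c) := by
    rw [Subgroup.closure_le]
    rintro _ (rfl | rfl)
    · exact ⟨dvd_rfl, hb, hc⟩
    · exact ⟨ha, dvd_rfl, by simpa using dvd_sub hc (dvd_refl (X.c - _))⟩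
  refine le_antisymm hle fun t ht => ?_
  have hX : X * X = translation X.a 0 0 := by
    ext <;> simp [paritySign_of_even, paritySign_of_odd, *]; ring
  have hY : Y * Y = translation 0 Y.b 0 := by
    ext <;> simp [paritySign_of_even, paritySign_of_odd, *]; ring
  have hXY : (X * Y) * (X * Y) = translation 0 0 (X.c - Y.c) := by
    ext <;> simp [paritySign_of_even, paritySign_of_odd, paritySign_add, *]; ring
  have htrans (s : HWModel) (hs : s ∈ sublattice X.a Y.b (X.c - Y.c)) (hsa : Even s.a)
      (hsb : Even s.b) : s ∈ Subgroup.closure {X, Y} := by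
    have hsc : Even s.c := by have := s.even; grind
    obtain ⟨a, b, c, hs'⟩ := s
    obtain ⟨h1, h2, h3⟩ := hs
    obtain ⟨u, rfl⟩ := even_iff_two_dvd.1 hsa
    obtain ⟨v, rfl⟩ := even_iff_two_dvd.1 hsb
    obtain ⟨w, rfl⟩ := even_iff_two_dvd.1 hsc
    obtain ⟨u, rfl⟩ := dvd_of_dvd_two_mul hXa h1
    obtain ⟨v, rfl⟩ := dvd_of_dvd_two_mul hYb h2
    obtain ⟨w, rfl⟩ := dvd_of_dvd_two_mul (hXc.sub_odd hYc) h3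
    have : (X * X) ^ u * (Y * Y) ^ v * ((X * Y) * (X * Y)) ^ w =
        (⟨2 * (X.a * u), 2 * (Y.b * v), 2 * ((X.c - Y.c) * w), hs'⟩ : HWModel) := by
      rw [hX, hY, hXY]
      simp only [translation_zpow, translation_mul]
      ext <;> simp <;> ring
    rw [← this]
    exact mul_mem (mul_mem (zpow_mem (mul_mem hXm hXm) _) (zpow_mem (mul_mem hYm hYm) _))
      (zpow_mem (mul_mem (mul_mem hXm hYm) (mul_mem hXm hYm)) _)
  have hcoset (r : HWModel) (hr : r ∈ Subgroup.closure {X, Y}) (hra : Even (r.a + t.a))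
      (hrb : Even (r.b + t.b)) : t ∈ Subgroup.closure {X, Y} := by
    refine (Subgroup.mul_mem_cancel_left _ hr).1
      (htrans (r * t) (mul_mem (hle hr) ht) ?_ ?_)
    · simpa [Int.even_add, even_paritySign_mul] using hra
    · simpa [Int.even_add, even_paritySign_mul] using hrb
  rcases Int.even_or_odd t.a with h1 | h1 <;> rcases Int.even_or_odd t.b with h2 | h2
  · exact htrans t ht h1 h2
  · exact hcoset Y hYm (hYa.add h1) (hYb.add_odd h2)
  · refine hcoset (X * Y) (mul_mem hXm hYm) ?_ ?_
    · simp [paritySign_of_even, hXc]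
      grind
    · simp [paritySign_of_odd, hXa]
      grind
  · exact hcoset X hXm (hXa.add_odd h1) (hXb.add_odd h2)

theorem ofHW_surjective : Function.Surjective ofHW := by
  rw [← MonoidHom.range_eq_top, MonoidHom.range_eq_map, ← closure_hwx_hwy, MonoidHom.map_closure,
    Set.image_pair, ofHW_hwx, ofHW_hwy,
    closure_eq_sublattice (by decide) (by decide) (by decide) (by decide) (by decide) (by decide)
      (by decide), eq_top_iff]
  intro t _
  simp [mem_sublattice, genX, genY]

theorem exists_dvd_add_four_mul {k : ℤ} (hk : Odd k) (a : ℤ) : ∃ u, k ∣ a + 4 * u := by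
  obtain ⟨j, rfl⟩ := hk
  exact ⟨(j ^ 2 + j) * a, (2 * j + 1) * a, by ring⟩

end HWModel

namespace HWModel

theorem sublattice_natAbs (k l m : ℤ) :
    sublattice k.natAbs l.natAbs m.natAbs = sublattice k l m := by
  ext t
  simp [mem_sublattice]

theorem exists_conj_closure_eq_sublattice {X Y : HWModel} (hXa : Odd X.a) (hXb : Odd X.b)
    (hYa : Even Y.a) (hYb : Odd Y.b) :
    ∃ g : HWModel, ∃ k l m : ℕ, Odd k ∧ Odd l ∧ Odd m ∧
      (Subgroup.closure {X, Y}).map (MulAut.conj g).toMonoidHom = sublattice k l m := by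
  have hXc : Even X.c := by have := X.even; grind
  have hYc : Odd Y.c := by have := Y.even; grind
  obtain ⟨u, hu⟩ := exists_dvd_add_four_mul hXa Y.a
  obtain ⟨v, hv⟩ := exists_dvd_add_four_mul hYb X.b
  obtain ⟨w, hw⟩ := exists_dvd_add_four_mul (hXc.sub_odd hYc) X.c
  let g := translation u v w
  have hX : (g * X * g⁻¹).a = X.a ∧ (g * X * g⁻¹).b = X.b + 4 * v ∧
      (g * X * g⁻¹).c = X.c + 4 * w := by
    refine ⟨?_, ?_, ?_⟩ <;>
      simp [g, paritySign_add, paritySign_of_even, paritySign_of_odd, hXa, hXb, hXc] <;> ring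
  have hY : (g * Y * g⁻¹).a = Y.a + 4 * u ∧ (g * Y * g⁻¹).b = Y.b ∧
      (g * Y * g⁻¹).c = Y.c + 4 * w := by
    refine ⟨?_, ?_, ?_⟩ <;>
      simp [g, paritySign_add, paritySign_of_even, paritySign_of_odd, hYa, hYb, hYc] <;> ring
  have h := closure_eq_sublattice (X := g * X * g⁻¹) (Y := g * Y * g⁻¹)
  rw [hX.1, hX.2.1, hX.2.2, hY.1, hY.2.1, hY.2.2,
    show X.c + 4 * w - (Y.c + 4 * w) = X.c - Y.c by ring] at h
  refine ⟨g, X.a.natAbs, Y.b.natAbs, (X.c - Y.c).natAbs, Int.natAbs_odd.2 hXa,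
    Int.natAbs_odd.2 hYb, Int.natAbs_odd.2 (hXc.sub_odd hYc), ?_⟩
  rw [sublattice_natAbs, MonoidHom.map_closure, Set.image_pair]
  exact h hXa (by grind) (by grind) hYb hu hv hw

theorem conj_relation_coords {X Y : HWModel} (h : X * Y ^ 2 * X⁻¹ * Y ^ 2 = 1) :
    (1 + paritySign X.c) * ((1 + paritySign Y.c) * Y.a) = 0 ∧
    (1 + paritySign X.a) * ((1 + paritySign Y.a) * Y.b) = 0 ∧
    (1 + paritySign X.b) * ((1 + paritySign Y.b) * Y.c) = 0 := by
  have h' := (semiconjBy_inv_of_rel h).eq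
  have ha := congrArg HWModel.a h'
  have hb := congrArg HWModel.b h'
  have hc := congrArg HWModel.c h'
  simp [pow_two, paritySign_add, ← mul_assoc] at ha hb hc
  exact ⟨by linear_combination ha, by linear_combination hb, by linear_combination hc⟩

theorem sq_coords_ne_zero {X : HWModel} (h : X ^ 2 ≠ 1) :
    ¬ ((1 + paritySign X.c) * X.a = 0 ∧ (1 + paritySign X.a) * X.b = 0 ∧
      (1 + paritySign X.b) * X.c = 0) := by
  rintro ⟨h1, h2, h3⟩
  apply h
  ext
  · simpa [pow_two, add_mul] using h1
  · simpa [pow_two, add_mul] using h2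
  · simpa [pow_two, add_mul] using h3

/-- Elements `A`, `B` satisfying the relations and with nontrivial squares have distinct nontrivial
linear parts. -/
theorem parity_cases_of_relations {A B : HWModel} (hAB : A * B ^ 2 * A⁻¹ * B ^ 2 = 1)
    (hBA : B * A ^ 2 * B⁻¹ * A ^ 2 = 1) (hA : A ^ 2 ≠ 1) (hB : B ^ 2 ≠ 1) :
    (Odd A.a ∧ Odd A.b ∧ Even B.a ∧ Odd B.b) ∨ (Even A.a ∧ Odd A.b ∧ Odd B.a ∧ Odd B.b) ∨
    (Odd A.a ∧ Odd A.b ∧ Odd B.a ∧ Even B.b) ∨ (Odd A.a ∧ Even A.b ∧ Odd B.a ∧ Odd B.b) ∨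
    (Even A.a ∧ Odd A.b ∧ Odd B.a ∧ Even B.b) ∨ (Odd A.a ∧ Even A.b ∧ Even B.a ∧ Odd B.b) := by
  replace hAB := conj_relation_coords hAB
  replace hBA := conj_relation_coords hBA
  replace hA := sq_coords_ne_zero hA
  replace hB := sq_coords_ne_zero hB
  have hAc : Even A.c ↔ (Even A.a ↔ Even A.b) := by have := A.even; grind
  have hBc : Even B.c ↔ (Even B.a ↔ Even B.b) := by have := B.even; grind
  simp only [← Int.not_even_iff_odd]
  simp only [paritySign, hAc, hBc] at hAB hBA hA hB
  clear hAc hBc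
  by_cases h1 : Even A.a <;> by_cases h2 : Even A.b <;> by_cases h3 : Even B.a <;>
    by_cases h4 : Even B.b <;> simp [h1, h2, h3, h4] at hAB hBA hA hB ⊢ <;> omega

theorem exists_conj_range_eq_sublattice (f : HW →* HWModel) (hf : Function.Injective f) :
    ∃ g : HWModel, ∃ k l m : ℕ, Odd k ∧ Odd l ∧ Odd m ∧
      f.range.map (MulAut.conj g).toMonoidHom = sublattice k l m := by
  have hrange : f.range = Subgroup.closure {f hwx, f hwy} := by
    rw [MonoidHom.range_eq_map, ← closure_hwx_hwy, MonoidHom.map_closure, Set.image_pair]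
  have hxyrel : f hwx * f hwy ^ 2 * (f hwx)⁻¹ * f hwy ^ 2 = 1 := by
    simpa only [map_mul, map_pow, map_inv, map_one] using congrArg f hwx_hwy_rel
  have hyxrel : f hwy * f hwx ^ 2 * (f hwy)⁻¹ * f hwx ^ 2 = 1 := by
    simpa only [map_mul, map_pow, map_inv, map_one] using congrArg f hwy_hwx_rel
  have hx : f hwx ^ 2 ≠ 1 := by
    rw [← map_pow, map_ne_one_iff f hf]
    intro h
    simpa [pow_two, genX] using congrArg (fun t => (ofHW t).a) h
  have hy : f hwy ^ 2 ≠ 1 := by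
    rw [← map_pow, map_ne_one_iff f hf]
    intro h
    simpa [pow_two, genY] using congrArg (fun t => (ofHW t).b) h
  rw [hrange]
  generalize f hwx = A at *
  generalize f hwy = B at *
  have conclude (X Y : HWModel) (hA : A ∈ Subgroup.closure {X, Y})
      (hB : B ∈ Subgroup.closure {X, Y}) (hX : X ∈ Subgroup.closure {A, B})
      (hY : Y ∈ Subgroup.closure {A, B}) (hXa : Odd X.a) (hXb : Odd X.b)
      (hYa : Even Y.a) (hYb : Odd Y.b) :
      ∃ g : HWModel, ∃ k l m : ℕ, Odd k ∧ Odd l ∧ Odd m ∧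
        (Subgroup.closure {A, B}).map (MulAut.conj g).toMonoidHom = sublattice k l m := by
    have : Subgroup.closure {A, B} = Subgroup.closure {X, Y} := by
      apply le_antisymm <;> rw [Subgroup.closure_le] <;> rintro _ (rfl | rfl) <;> assumption
    rw [this]
    exact exists_conj_closure_eq_sublattice hXa hXb hYa hYb
  have hA : A ∈ Subgroup.closure {A, B} := Subgroup.subset_closure (by simp)
  have hB : B ∈ Subgroup.closure {A, B} := Subgroup.subset_closure (by simp)
  have hAB := mul_mem hA hB
  have hABa : Even (A * B).a ↔ (Even A.a ↔ Even B.a) := by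
    simp [Int.even_add, even_paritySign_mul]
  have hABb : Even (A * B).b ↔ (Even A.b ↔ Even B.b) := by
    simp [Int.even_add, even_paritySign_mul]
  have hl (X Y : HWModel) : X ∈ Subgroup.closure {X, Y} := Subgroup.subset_closure (by simp)
  have hr (X Y : HWModel) : Y ∈ Subgroup.closure {X, Y} := Subgroup.subset_closure (by simp)
  have hA₁ : A ∈ Subgroup.closure {A * B, B} :=
    (Subgroup.mul_mem_cancel_right _ (hr _ _)).1 (hl (A * B) B)
  have hB₁ : B ∈ Subgroup.closure {A * B, A} :=
    (Subgroup.mul_mem_cancel_left _ (hr _ _)).1 (hl (A * B) A)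
  have hA₂ : A ∈ Subgroup.closure {B, A * B} := Set.pair_comm B (A * B) ▸ hA₁
  have hB₂ : B ∈ Subgroup.closure {A, A * B} := Set.pair_comm A (A * B) ▸ hB₁
  have hcases := parity_cases_of_relations hxyrel hyxrel hx hy
  simp only [← Int.not_even_iff_odd] at hcases conclude
  rcases hcases with ⟨h1, h2, h3, h4⟩ | ⟨h1, h2, h3, h4⟩ | ⟨h1, h2, h3, h4⟩ | ⟨h1, h2, h3, h4⟩ |
    ⟨h1, h2, h3, h4⟩ | ⟨h1, h2, h3, h4⟩
  · exact conclude A B hA hB hA hB h1 h2 h3 h4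
  · exact conclude B A (hr _ _) (hl _ _) hB hA h3 h4 h1 h2
  · exact conclude A (A * B) (hl _ _) hB₂ hA hAB h1 h2 (by tauto) (by tauto)
  · exact conclude B (A * B) hA₂ (hl _ _) hB hAB h3 h4 (by tauto) (by tauto)
  · exact conclude (A * B) A (hr _ _) hB₁ hAB hA (by tauto) (by tauto) h1 h2
  · exact conclude (A * B) B hA₁ (hr _ _) hAB hB (by tauto) (by tauto) h3 h4

end HWModel

open HWModel in
theorem conj_comap_ofHW {H K : Subgroup HW} {g : HW}
    (h : (H.map ofHW).map (MulAut.conj (ofHW g)).toMonoidHom = K.map ofHW) :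
    H.map (MulAut.conj g).toMonoidHom = K := by
  apply Subgroup.map_injective ofHW_injective
  rw [← h, Subgroup.map_map, Subgroup.map_map]
  congr 1
  ext t <;> simp

theorem conjClass_map_conj (H : Subgroup HW) (g : HW) :
    conjClass (H.map (MulAut.conj g).toMonoidHom) = conjClass H := by
  have hcomp (g h : HW) (H : Subgroup HW) : (H.map (MulAut.conj g).toMonoidHom).map
      (MulAut.conj h).toMonoidHom = H.map (MulAut.conj (h * g)).toMonoidHom := by
    rw [Subgroup.map_map]
    congr 1
    ext t
    simp [mul_assoc]
  ext K
  constructor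
  · rintro ⟨h, rfl⟩
    exact ⟨h * g, hcomp _ _ _⟩
  · rintro ⟨h, rfl⟩
    exact ⟨h * g⁻¹, by rw [hcomp]; simp⟩

theorem self_mem_conjClass (H : Subgroup HW) : H ∈ conjClass H :=
  ⟨1, by ext; simp⟩

open HWModel in
theorem dvd_of_comap_mem_conjClass {k l m k' l' m' : ℕ}
    (hk' : Odd k') (hl' : Odd l') (hm' : Odd m')
    (h : (sublattice k' l' m').comap ofHW ∈ conjClass ((sublattice k l m).comap ofHW)) :
    k' ∣ k ∧ l' ∣ l ∧ m' ∣ m := by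
  obtain ⟨g, hg⟩ := h
  refine dvd_of_conj_mem_sublattice hk' hl' hm' (g := ofHW g) fun t ht => ?_
  obtain ⟨t, rfl⟩ := ofHW_surjective t
  have : g * t * g⁻¹ ∈ (sublattice k' l' m').comap ofHW := hg ▸ ⟨t, ht, rfl⟩
  simpa using this

open HWModel in
theorem nonempty_comap_sublattice_mulEquiv {k l m : ℕ} (hk : Odd k) (hl : Odd l) (hm : Odd m) :
    Nonempty ((sublattice k l m).comap ofHW ≃* HW) := by
  let e : HW ≃* HWModel := MulEquiv.ofBijective ofHW ⟨ofHW_injective, ofHW_surjective⟩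
  have hk' : Odd (k : ℤ) := by exact_mod_cast hk
  have hl' : Odd (l : ℤ) := by exact_mod_cast hl
  have hm' : Odd (m : ℤ) := by exact_mod_cast hm
  let f : HW →* HWModel := (scale hk' hl' hm').comp ofHW
  have hf : Function.Injective (e.symm.toMonoidHom.comp f) :=
    e.symm.injective.comp ((scale_injective hk' hl' hm').comp ofHW_injective)
  have hrange : (e.symm.toMonoidHom.comp f).range = (sublattice k l m).comap ofHW := by
    rw [MonoidHom.range_comp, MonoidHom.range_comp, MonoidHom.range_eq_top.2 ofHW_surjective,
      ← MonoidHom.range_eq_map, range_scale]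
    exact (Subgroup.comap_equiv_eq_map_symm e _).symm
  exact ⟨((MonoidHom.ofInjective hf).trans (MulEquiv.subgroupCongr hrange)).symm⟩

open HWModel in
theorem card_conjClass (n : ℕ) :
    Nat.card {S : Set (Subgroup HW) //
        ∃ H : Subgroup HW, H.index = n ∧ Nonempty (H ≃* HW) ∧ S = conjClass H} =
      oddTriples n := by
  unfold oddTriples
  rw [← Nat.card_eq_finsetCard]
  symm
  have hindex {k l m : ℕ} (hk : Odd k) (hl : Odd l) (hm : Odd m) :
      ((sublattice k l m).comap ofHW).index = k * l * m := by
    rw [Subgroup.index_comap_of_surjective _ ofHW_surjective, index_sublattice hk hl hm]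
  refine Nat.card_eq_of_bijective (fun t => ⟨conjClass
    ((sublattice t.1.1 t.1.2.1 t.1.2.2).comap ofHW), ?_⟩) ⟨?_, ?_⟩
  · obtain ⟨-, hk, hl, hm, h⟩ := Finset.mem_filter.1 t.2
    exact ⟨_, (hindex hk hl hm).trans h, nonempty_comap_sublattice_mulEquiv hk hl hm, rfl⟩
  · rintro ⟨⟨k, l, m⟩, ht⟩ ⟨⟨k', l', m'⟩, ht'⟩ h
    obtain ⟨-, hk, hl, hm, -⟩ := Finset.mem_filter.1 ht
    obtain ⟨-, hk', hl', hm', -⟩ := Finset.mem_filter.1 ht'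
    have h := congrArg Subtype.val h
    dsimp only at hk hl hm hk' hl' hm' h
    obtain ⟨h1, h2, h3⟩ := dvd_of_comap_mem_conjClass hk hl hm (h ▸ self_mem_conjClass _)
    obtain ⟨h1', h2', h3'⟩ := dvd_of_comap_mem_conjClass hk' hl' hm'
      (h.symm ▸ self_mem_conjClass _)
    simp [Nat.dvd_antisymm h1 h1', Nat.dvd_antisymm h2 h2',
      Nat.dvd_antisymm h3 h3']
  · rintro ⟨_, H, hH, ⟨e⟩, rfl⟩
    obtain ⟨g, k, l, m, hk, hl, hm, h⟩ := exists_conj_range_eq_sublattice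
      (ofHW.comp (H.subtype.comp e.symm.toMonoidHom))
      (ofHW_injective.comp (H.subtype_injective.comp e.symm.injective))
    obtain ⟨g, rfl⟩ := ofHW_surjective g
    have hr : (ofHW.comp (H.subtype.comp e.symm.toMonoidHom)).range = H.map ofHW := by
      rw [MonoidHom.range_comp, MonoidHom.range_comp,
        MonoidHom.range_eq_top.2 (show Function.Surjective e.symm.toMonoidHom from
          e.symm.surjective), ← MonoidHom.range_eq_map, Subgroup.range_subtype]
    rw [hr, ← Subgroup.map_comap_eq_self_of_surjective ofHW_surjective (sublattice k l m)] at h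
    have hconj := conj_comap_ofHW h
    have hprod : k * l * m = n := by
      rw [← hindex hk hl hm, ← hconj, ← hH]
      exact Subgroup.index_map_equiv H (MulAut.conj g)
    refine ⟨⟨(k, l, m), ?_⟩, Subtype.ext ?_⟩
    · have hn : 0 < n := hprod ▸ Nat.mul_pos (Nat.mul_pos hk.pos hl.pos) hm.pos
      have h1 : k ≤ n := Nat.le_of_dvd hn ⟨l * m, by rw [← hprod]; ring⟩
      have h2 : l ≤ n := Nat.le_of_dvd hn ⟨k * m, by rw [← hprod]; ring⟩
      have h3 : m ≤ n := Nat.le_of_dvd hn ⟨k * l, by rw [← hprod]; ring⟩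
      simp only [Finset.mem_filter, Finset.mem_product, Finset.mem_range]
      exact ⟨⟨by omega, by omega, by omega⟩, hk, hl, hm, hprod⟩
    · change conjClass ((sublattice k l m).comap ofHW) = conjClass H
      rw [← hconj, conjClass_map_conj]

theorem stmt14 (n : ℕ) (hn : 0 < n) :
    Nat.card {S : Set (Subgroup HW) //
        ∃ H : Subgroup HW, H.index = n ∧ Nonempty (H ≃* HW) ∧ S = conjClass H} =
      oddTriples n ∧
    (oddTriples n : ℤ) = (d3 n : ℤ) - 3 * d3If n 2 + 3 * d3If n 4 - d3If n 8 := by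
  exact ⟨card_conjClass n, oddTriples_eq n hn⟩
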